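/- arXiv:1504.04422 — 2 statements merged into one kernel-verified Lean document; each statement's English description precedes it below -/
import Mathlib

section
/- Let Γ be a finite connected non-complete graph of prime valency p that is 2-geodesic transitive but not 2-arc transitive (equivalently, Γ has girth 3). Then p ≡ 1 (mod 4). -/
open SimpleGraph

/-- `Γ` is arc transitive: its automorphism group is transitive on ordered pairs
of adjacent vertices. -/
def ArcTransitive {V : Type*} (Γ : SimpleGraph V) : Prop :=
  ∀ ⦃v u v' u' : V⦄, Γ.Adj v u → Γ.Adj v' u' →
    ∃ φ : Γ ≃g Γ, φ v = v' ∧ φ u = u'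

/-- `(v,u,w)` is a 2-arc of `Γ`. -/
def Is2Arc {V : Type*} (Γ : SimpleGraph V) (v u w : V) : Prop :=
  Γ.Adj v u ∧ Γ.Adj u w ∧ v ≠ w

/-- `(v,u,w)` is a 2-geodesic of `Γ`: a 2-arc with `v`, `w` non-adjacent. -/
def Is2Geodesic {V : Type*} (Γ : SimpleGraph V) (v u w : V) : Prop :=
  Γ.Adj v u ∧ Γ.Adj u w ∧ v ≠ w ∧ ¬ Γ.Adj v w

/-- `Γ` is 2-arc transitive: arc transitive and transitive on 2-arcs. -/
def TwoArcTransitive {V : Type*} (Γ : SimpleGraph V) : Prop :=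
  ArcTransitive Γ ∧
  ∀ ⦃v u w v' u' w' : V⦄, Is2Arc Γ v u w → Is2Arc Γ v' u' w' →
    ∃ φ : Γ ≃g Γ, φ v = v' ∧ φ u = u' ∧ φ w = w'

/-- `Γ` is 2-geodesic transitive: arc transitive and transitive on 2-geodesics. -/
def TwoGeodesicTransitive {V : Type*} (Γ : SimpleGraph V) : Prop :=
  ArcTransitive Γ ∧
  ∀ ⦃v u w v' u' w' : V⦄, Is2Geodesic Γ v u w → Is2Geodesic Γ v' u' w' →
    ∃ φ : Γ ≃g Γ, φ v = v' ∧ φ u = u' ∧ φ w = w'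

/-- The matrix of translation by `t` on an additive group. -/
def translationMatrix (R : Type*) [Zero R] [One R] {A : Type*} [Add A] [DecidableEq A] (t : A) :
    Matrix A A R :=
  Matrix.of fun i j => if j = i + t then 1 else 0

section translationMatrix

variable {R A : Type*} [Semiring R] [AddCommGroup A] [Fintype A] [DecidableEq A]

theorem translationMatrix_mul (s t : A) :
    translationMatrix R s * translationMatrix R t = translationMatrix R (s + t) := by
  ext i j
  simp only [translationMatrix, Matrix.mul_apply, Matrix.of_apply, ite_mul, one_mul, zero_mul]
  rw [Finset.sum_ite_eq' Finset.univ (i + s), if_pos (Finset.mem_univ _), add_assoc]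

theorem translationMatrix_pow (t : A) (n : ℕ) :
    translationMatrix R t ^ n = translationMatrix R (n • t) := by
  induction n with
  | zero => ext i j; simp [translationMatrix, Matrix.one_apply, eq_comm]
  | succ n ih => rw [pow_succ, ih, translationMatrix_mul, succ_nsmul]

omit [Fintype A] in
theorem sum_translationMatrix_apply (S : Finset A) (i j : A) :
    (∑ t ∈ S, translationMatrix R t) i j = if j - i ∈ S then 1 else 0 := by
  rw [Matrix.sum_apply]
  simp only [translationMatrix, Matrix.of_apply, ← sub_eq_iff_eq_add', Finset.sum_ite_eq]

theorem sum_translationMatrix_pow (q : ℕ) [Fact q.Prime] [CharP R q] (S : Finset A) :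
    (∑ t ∈ S, translationMatrix R t) ^ q = ∑ t ∈ S, translationMatrix R (q • t) := by
  induction S using Finset.induction_on with
  | empty => simp [(Fact.out : q.Prime).ne_zero]
  | insert a S ha ih =>
    have : CharP (Matrix A A R) q := Matrix.charP q
    rw [Finset.sum_insert ha, Finset.sum_insert ha, add_pow_char_of_commute, ih,
      translationMatrix_pow]
    refine Commute.sum_right _ _ _ fun t _ => ?_
    rw [Commute, SemiconjBy, translationMatrix_mul, translationMatrix_mul, add_comm]

end translationMatrix

/-- The permutation `g` preserves the Cayley relation `j - i ∈ S`. -/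
def PreservesCayley {A : Type*} [Sub A] (g : Equiv.Perm A) (S : Finset A) : Prop :=
  ∀ i j, g j - g i ∈ S ↔ j - i ∈ S

theorem PreservesCayley.image_prime_mul {p : ℕ} [Fact p.Prime] {g : Equiv.Perm (ZMod p)}
    {S : Finset (ZMod p)} (h : PreservesCayley g S) {q : ℕ} (hq : q.Prime)
    (hqp : (q : ZMod p) ≠ 0) : PreservesCayley g (S.image ((q : ZMod p) * ·)) := by
  have : Fact q.Prime := ⟨hq⟩
  set B : Matrix (ZMod p) (ZMod p) (ZMod q) := ∑ t ∈ S, translationMatrix (ZMod q) t with hB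
  have hinv : Matrix.reindexAlgEquiv (ZMod q) (ZMod q) g.symm B = B := by
    ext i j
    rw [Matrix.coe_reindexAlgEquiv, Matrix.reindex_apply, Matrix.submatrix_apply, hB,
      sum_translationMatrix_apply, sum_translationMatrix_apply]
    exact if_congr (h i j) rfl rfl
  have hpow : Matrix.reindexAlgEquiv (ZMod q) (ZMod q) g.symm (B ^ q) = B ^ q := by
    rw [map_pow, hinv]
  have hBq : B ^ q = ∑ t ∈ S.image ((q : ZMod p) * ·), translationMatrix (ZMod q) t := by
    rw [hB, sum_translationMatrix_pow, Finset.sum_image]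
    · simp
    · intro a _ b _ hab
      exact mul_left_cancel₀ hqp hab
  intro i j
  have := congrFun (congrFun hpow i) j
  rw [hBq, Matrix.coe_reindexAlgEquiv, Matrix.reindex_apply, Matrix.submatrix_apply,
    sum_translationMatrix_apply, sum_translationMatrix_apply] at this
  simp only [Equiv.symm_symm] at this
  generalize S.image ((q : ZMod p) * ·) = U at this ⊢
  by_cases h1 : g j - g i ∈ U <;> by_cases h2 : j - i ∈ U <;> simp_all

theorem PreservesCayley.image_natCast_mul {p : ℕ} [Fact p.Prime] {g : Equiv.Perm (ZMod p)}
    {S : Finset (ZMod p)} (h : PreservesCayley g S) (m : ℕ) (hm : (m : ZMod p) ≠ 0) :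
    PreservesCayley g (S.image ((m : ZMod p) * ·)) := by
  induction m using induction_on_primes with
  | zero => simp at hm
  | one => simpa using h
  | prime_mul q a hq ih =>
    push_cast at hm ⊢
    have := (ih (right_ne_zero_of_mul hm)).image_prime_mul hq (left_ne_zero_of_mul hm)
    simpa [Finset.image_image, Function.comp_def, mul_assoc] using this

open scoped Pointwise in
/-- If the multiplicative translates of a nonempty set of units either coincide with it or are
disjoint from it, the set is a coset of its stabilizer. -/
theorem card_dvd_pred_of_translates {p : ℕ} [Fact p.Prime] {T : Finset (ZMod p)}
    (h0 : 0 ∉ T) (hT : T.Nonempty)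
    (htr : ∀ m : ZMod p, m ≠ 0 → ∀ t ∈ T, m * t ∈ T → T.image (m * ·) = T) :
    T.card ∣ p - 1 := by
  classical
  obtain ⟨t₀, ht₀⟩ := hT
  have ht₀' : t₀ ≠ 0 := fun h => h0 (h ▸ ht₀)
  let H := MulAction.stabilizer (ZMod p)ˣ (T : Set (ZMod p))
  have hH : ∀ m : (ZMod p)ˣ, m ∈ H ↔ (m : ZMod p) * t₀ ∈ T := by
    intro m
    rw [MulAction.mem_stabilizer_iff]
    constructor
    · intro h
      have : m • t₀ ∈ m • (T : Set (ZMod p)) := Set.smul_mem_smul_set ht₀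
      rwa [h] at this
    · intro h
      have := congrArg (fun S : Finset (ZMod p) => (S : Set (ZMod p))) (htr m m.ne_zero t₀ ht₀ h)
      rwa [Finset.coe_image] at this
  have hcard : Nat.card H = T.card := by
    rw [← Fintype.card_coe, ← Nat.card_eq_fintype_card]
    refine Nat.card_eq_of_bijective (fun m : H => (⟨(m.1 : ZMod p) * t₀, (hH m.1).1 m.2⟩ : T))
      ⟨fun a b hab => ?_, fun t => ?_⟩
    · exact Subtype.ext (Units.ext (mul_right_cancel₀ ht₀' (congrArg Subtype.val hab)))
    · have ht : t.1 ≠ 0 := fun h => h0 (h ▸ t.2)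
      have hmul : t.1 / t₀ * t₀ = t.1 := div_mul_cancel₀ _ ht₀'
      exact ⟨⟨Units.mk0 _ (div_ne_zero ht ht₀'), (hH _).2 (by simp [hmul])⟩,
        Subtype.ext hmul⟩
  rw [← hcard, ← ZMod.card_units p, ← Nat.card_eq_fintype_card]
  exact Subgroup.card_subgroup_dvd_card H

theorem card_dvd_pred_of_transitive {p : ℕ} [Fact p.Prime] {T : Finset (ZMod p)}
    (h0 : 0 ∉ T) (hT : T.Nonempty)
    (htr : ∀ s ∈ T, ∀ t ∈ T, ∃ g : Equiv.Perm (ZMod p), PreservesCayley g T ∧ g 0 = 0 ∧ g s = t) :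
    T.card ∣ p - 1 := by
  refine card_dvd_pred_of_translates h0 hT fun m hm t ht hmt => ?_
  symm
  refine Finset.eq_of_subset_of_card_le (fun s hs => ?_) Finset.card_image_le
  obtain ⟨g, hg, hg0, hgt⟩ := htr _ hmt s hs
  have := hg.image_natCast_mul m.val (by simpa using hm) 0 (m * t)
  rw [hg0, hgt, sub_zero, sub_zero, ZMod.natCast_zmod_val] at this
  exact this.2 (Finset.mem_image_of_mem _ ht)

/-- A vertex-transitive graph of prime order has a cyclic labelling by `ZMod p` for which it is
a circulant graph. -/
theorem exists_zmod_labelling {X : Type*} [Finite X] {p : ℕ} [Fact p.Prime]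
    (hX : Nat.card X = p) (S : SimpleGraph X) (hS : ∀ x y : X, ∃ φ : S ≃g S, φ x = y) :
    ∃ e : ZMod p ≃ X, ∀ i j n, S.Adj (e (i + n)) (e (j + n)) ↔ S.Adj (e i) (e j) := by
  have hp : p.Prime := Fact.out
  have : Fintype X := Fintype.ofFinite X
  have : Finite (S ≃g S) := Finite.of_injective (fun φ => (φ : X → X)) DFunLike.coe_injective
  have : Nonempty X := (Nat.card_pos_iff.1 (hX ▸ hp.pos)).1
  have htrans : MulAction.IsPretransitive (S ≃g S) X := ⟨hS⟩
  obtain ⟨x₁⟩ := this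
  have hdvd : p ∣ Nat.card (S ≃g S) := by
    rw [← hX, ← MulAction.index_stabilizer_of_transitive (S ≃g S) x₁]
    exact Subgroup.index_dvd_card _
  obtain ⟨g, hg⟩ := exists_prime_orderOf_dvd_card' p hdvd
  have hne : g ≠ 1 := by
    rintro rfl
    rw [orderOf_one] at hg
    exact hp.one_lt.ne hg
  obtain ⟨x₀, hx₀⟩ : ∃ x, g x ≠ x := by
    by_contra! h
    exact hne (DFunLike.ext _ _ h)
  have hit : ∀ n x, (g ^ n) x = g^[n] x := by
    intro n
    induction n with
    | zero => intro x; rfl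
    | succ n ih => intro x; rw [pow_succ, RelIso.mul_apply, ih, Function.iterate_succ_apply]
  have hper : Function.minimalPeriod g x₀ = p := by
    refine Function.minimalPeriod_eq_prime_iff.2 ⟨?_, hx₀⟩
    rw [Function.IsPeriodicPt, Function.IsFixedPt, ← hit, ← hg, pow_orderOf_eq_one]
    rfl
  have hinj : Function.Injective fun i : ZMod p => g^[i.val] x₀ := by
    intro i j hij
    have hlt : ∀ i : ZMod p, i.val ∈ Set.Iio (Function.minimalPeriod g x₀) := fun i => by
      rw [hper]; exact i.val_lt
    exact ZMod.val_injective p (Function.iterate_injOn_Iio_minimalPeriod (hlt i) (hlt j) hij)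
  let e : ZMod p ≃ X := Equiv.ofBijective _ <| (Fintype.bijective_iff_injective_and_card _).2
    ⟨hinj, by rw [ZMod.card, ← hX, Nat.card_eq_fintype_card]⟩
  have he : ∀ i n, e (i + n) = (g ^ n.val) (e i) := by
    intro i n
    change g^[(i + n).val] x₀ = (g ^ n.val) (g^[i.val] x₀)
    rw [hit, ← Function.iterate_add_apply, ZMod.val_add, add_comm n.val]
    have := Function.iterate_mod_minimalPeriod_eq (f := g) (x := x₀) (n := i.val + n.val)
    rwa [hper] at this
  exact ⟨e, fun i j n => by rw [he, he, SimpleGraph.Iso.map_adj_iff]⟩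

/-- The valency of an arc-transitive graph on `p` vertices divides `p - 1`. -/
theorem ArcTransitive.valency_dvd {X : Type*} [Fintype X] {p : ℕ} (hp : p.Prime)
    (hX : Nat.card X = p) {S : SimpleGraph X} [DecidableRel S.Adj] (hS : ArcTransitive S) {k : ℕ}
    (hk : 0 < k) (hreg : S.IsRegularOfDegree k) : k ∣ p - 1 := by
  classical
  have : Fact p.Prime := ⟨hp⟩
  have hnb : ∀ x, ∃ y, S.Adj x y := fun x => by
    rw [← S.degree_pos_iff_exists_adj, hreg x]; exact hk
  obtain ⟨e, he⟩ := exists_zmod_labelling hX S fun x y => by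
    obtain ⟨x', hx'⟩ := hnb x
    obtain ⟨y', hy'⟩ := hnb y
    obtain ⟨φ, h, -⟩ := hS hx' hy'
    exact ⟨φ, h⟩
  let T : Finset (ZMod p) := {i | S.Adj (e 0) (e i)}
  have hT : ∀ i, i ∈ T ↔ S.Adj (e 0) (e i) := by simp [T]
  have hadj : ∀ i j, j - i ∈ T ↔ S.Adj (e i) (e j) := fun i j => by
    rw [hT, ← he 0 (j - i) i, zero_add, sub_add_cancel]
  have hcard : T.card = k := by
    rw [← hreg (e 0), ← S.card_neighborFinset_eq_degree]
    exact Finset.card_equiv e (by simp [hT])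
  rw [← hcard]
  refine card_dvd_pred_of_transitive (by simp [hT]) (Finset.card_pos.1 (hcard ▸ hk))
    fun s hs t ht => ?_
  obtain ⟨φ, h1, h2⟩ := hS ((hT s).1 hs) ((hT t).1 ht)
  refine ⟨(e.trans φ.toEquiv).trans e.symm, fun i j => ?_, ?_, ?_⟩
  · rw [hadj, hadj]; simpa using φ.map_adj_iff
  · simp [h1]
  · simp [h2]

section neighborhoods

variable {V : Type*} [Fintype V] [DecidableEq V] {Γ : SimpleGraph V} [DecidableRel Γ.Adj]

/-- The neighbours of `u` at distance two from its neighbour `x`. -/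
def farNeighbors (Γ : SimpleGraph V) [DecidableRel Γ.Adj] (u x : V) : Finset V :=
  (Γ.neighborFinset u \ Γ.neighborFinset x).erase x

theorem mem_farNeighbors {u x y : V} :
    y ∈ farNeighbors Γ u x ↔ y ≠ x ∧ Γ.Adj u y ∧ ¬ Γ.Adj x y := by
  simp [farNeighbors]

theorem card_farNeighbors_add {u x : V} (h : Γ.Adj u x) :
    (farNeighbors Γ u x).card + 1 + (Γ.neighborFinset u ∩ Γ.neighborFinset x).card =
      Γ.degree u := by
  rw [farNeighbors, Finset.card_erase_add_one (by simpa using h),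
    Finset.card_sdiff_add_card_inter, card_neighborFinset_eq_degree]

theorem card_inter_neighborFinset_map (φ : Γ ≃g Γ) (x y : V) :
    (Γ.neighborFinset (φ x) ∩ Γ.neighborFinset (φ y)).card =
      (Γ.neighborFinset x ∩ Γ.neighborFinset y).card :=
  (Finset.card_equiv φ.toEquiv fun z => by
    simpa using and_congr φ.map_adj_iff.symm φ.map_adj_iff.symm).symm

/-- The non-adjacency graph on the neighbourhood of `u`. -/
abbrev nonadjacencyGraph (Γ : SimpleGraph V) (u : V) : SimpleGraph (Γ.neighborSet u) :=
  (Γ.induce (Γ.neighborSet u))ᶜ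

omit [Fintype V] [DecidableEq V] [DecidableRel Γ.Adj] in
theorem TwoGeodesicTransitive.arcTransitive_nonadjacencyGraph (h : TwoGeodesicTransitive Γ)
    (u : V) : ArcTransitive (nonadjacencyGraph Γ u) := by
  rintro ⟨x, hx⟩ ⟨y, hy⟩ ⟨x', hx'⟩ ⟨y', hy'⟩ hxy hxy'
  simp only [compl_adj, ne_eq, Subtype.mk.injEq, comap_adj, Function.Embedding.subtype_apply]
    at hxy hxy'
  rw [mem_neighborSet] at hx hy hx' hy'
  obtain ⟨φ, h1, h2, h3⟩ := h.2 ⟨hx.symm, hy, hxy⟩ ⟨hx'.symm, hy', hxy'⟩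
  refine ⟨⟨φ.toEquiv.subtypeEquiv fun a => ?_, ?_⟩, Subtype.ext h1, Subtype.ext h3⟩
  · rw [mem_neighborSet, mem_neighborSet]
    nth_rw 2 [← h2]
    exact φ.map_adj_iff.symm
  · rintro ⟨a, ha⟩ ⟨b, hb⟩
    simpa using fun _ => not_congr φ.map_adj_iff

theorem degree_nonadjacencyGraph (u : V) (x : Γ.neighborSet u)
    [Fintype ((nonadjacencyGraph Γ u).neighborSet x)] :
    (nonadjacencyGraph Γ u).degree x = (farNeighbors Γ u x).card := by
  rw [← card_neighborFinset_eq_degree, ← Finset.card_map (Function.Embedding.subtype _)]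
  congr 1
  ext y
  simp only [Finset.mem_map, mem_neighborFinset, compl_adj, comap_adj,
    Function.Embedding.subtype_apply, mem_farNeighbors, Subtype.exists, exists_and_right,
    exists_eq_right, mem_neighborSet, Subtype.ext_iff, ne_eq]
  tauto

/-- If vertices at distance two in the neighbourhood of `u` are twins, then that neighbourhood
is partitioned into classes of twins. -/
theorem succ_dvd_degree_of_twins {u : V} {k : ℕ}
    (hk : ∀ x, Γ.Adj u x → (farNeighbors Γ u x).card = k)
    (htwin : ∀ x, ∀ y ∈ farNeighbors Γ u x, Γ.Adj u x →
      Γ.neighborFinset y = Γ.neighborFinset x) : k + 1 ∣ Γ.degree u := by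
  rw [← card_neighborFinset_eq_degree,
    Finset.card_eq_sum_card_image (fun x => Γ.neighborFinset x) (Γ.neighborFinset u)]
  refine Finset.dvd_sum fun b hb => ?_
  obtain ⟨x, hx, rfl⟩ := Finset.mem_image.1 hb
  rw [mem_neighborFinset] at hx
  have hfib : {y ∈ Γ.neighborFinset u | Γ.neighborFinset y = Γ.neighborFinset x} =
      insert x (farNeighbors Γ u x) := by
    ext y
    rw [Finset.mem_filter, Finset.mem_insert, mem_neighborFinset]
    constructor
    · rintro ⟨hy, hyx⟩
      refine or_iff_not_imp_left.2 fun hne => mem_farNeighbors.2 ⟨hne, hy, fun hadj => ?_⟩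
      rw [← mem_neighborFinset, ← hyx, mem_neighborFinset] at hadj
      exact Γ.irrefl hadj
    · rintro (rfl | hy)
      · exact ⟨hx, rfl⟩
      · exact ⟨(mem_farNeighbors.1 hy).2.1, htwin x y hy hx⟩
  rw [hfib, Finset.card_insert_of_notMem (by simp [mem_farNeighbors]), hk x hx]

/-- Counting edges between the neighbourhood of `u` and the second neighbourhood of `u`. -/
theorem card_commonNeighbors_dvd {u : V} {k c : ℕ}
    (hk : ∀ x, Γ.Adj u x → (farNeighbors Γ x u).card = k)
    (hc : ∀ x w, Is2Geodesic Γ u x w → (Γ.neighborFinset u ∩ Γ.neighborFinset w).card = c) :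
    c ∣ Γ.degree u * k := by
  classical
  let W : Finset V := {w | ∃ x, Is2Geodesic Γ u x w}
  have := Finset.card_mul_eq_card_mul Γ.Adj (s := Γ.neighborFinset u) (t := W) (m := k) (n := c)
    (fun x hx => ?_) (fun w hw => ?_)
  · rw [← card_neighborFinset_eq_degree, this]
    exact dvd_mul_left _ _
  · rw [mem_neighborFinset] at hx
    rw [← hk x hx]
    congr 1
    ext w
    simp only [Finset.bipartiteAbove, Finset.mem_filter, W, Finset.mem_univ, true_and,
      mem_farNeighbors]
    constructor
    · rintro ⟨⟨y, -, -, hne, hna⟩, hxw⟩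
      exact ⟨hne.symm, hxw, hna⟩
    · rintro ⟨hne, hxw, hna⟩
      exact ⟨⟨x, hx, hxw, hne.symm, hna⟩, hxw⟩
  · obtain ⟨x, hx⟩ := (Finset.mem_filter.1 hw).2
    rw [← hc x w hx]
    congr 1
    ext y
    simp [Finset.bipartiteBelow, Γ.adj_comm y w]

/-- Inclusion-exclusion inside the neighbourhood of `u`. -/
theorem card_commonNeighbors_lower_bound {x u w : V} (h : Is2Geodesic Γ x u w) :
    (Γ.neighborFinset u ∩ Γ.neighborFinset x).card +
      (Γ.neighborFinset u ∩ Γ.neighborFinset w).card + 3 ≤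
      (Γ.neighborFinset x ∩ Γ.neighborFinset w).card + Γ.degree u := by
  obtain ⟨hxu, huw, hne, hna⟩ := h
  set A := Γ.neighborFinset u ∩ Γ.neighborFinset x with hA
  set B := Γ.neighborFinset u ∩ Γ.neighborFinset w with hB
  have hunion : (A ∪ B).card + 2 ≤ Γ.degree u := by
    have hsub : insert x (insert w (A ∪ B)) ⊆ Γ.neighborFinset u := by
      intro y
      simp only [hA, hB, Finset.mem_insert, Finset.mem_union, Finset.mem_inter, mem_neighborFinset]
      rintro (rfl | rfl | h | h)
      exacts [hxu.symm, huw, h.1, h.1]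
    have := Finset.card_le_card hsub
    rwa [Finset.card_insert_of_notMem, Finset.card_insert_of_notMem,
      card_neighborFinset_eq_degree] at this
    · simp [hA, hB, hna]
    · simp [hA, hB, hne, Γ.adj_comm w x, hna]
  have hinter : (A ∩ B).card + 1 ≤ (Γ.neighborFinset x ∩ Γ.neighborFinset w).card := by
    have hsub : insert u (A ∩ B) ⊆ Γ.neighborFinset x ∩ Γ.neighborFinset w := by
      intro y
      simp only [hA, hB, Finset.mem_insert, Finset.mem_inter, mem_neighborFinset]
      rintro (rfl | h)
      exacts [⟨hxu, huw.symm⟩, ⟨h.1.2, h.2.2⟩]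
    have := Finset.card_le_card hsub
    rwa [Finset.card_insert_of_notMem (by simp [hA])] at this
  have := Finset.card_union_add_card_inter A B
  omega

end neighborhoods

theorem exists_is2Geodesic {V : Type*} {Γ : SimpleGraph V} (hconn : Γ.Connected) (hnc : Γ ≠ ⊤) :
    ∃ x u w, Is2Geodesic Γ x u w := by
  by_contra! h
  have key : ∀ x y, Γ.Walk x y → x ≠ y → Γ.Adj x y := by
    intro x y q
    induction q with
    | nil => exact fun h => absurd rfl h
    | @cons a b c hab q ih =>
      intro hac
      by_contra hna
      by_cases hbc : b = c
      · exact hna (hbc ▸ hab)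
      · exact h a b c ⟨hab, ih hbc, hac, hna⟩
  refine hnc (SimpleGraph.ext ?_)
  ext x y
  rw [top_adj]
  exact ⟨fun h => h.ne, fun hne => (hconn x y).elim fun q => key x y q hne⟩

theorem exists_triangle {V : Type*} {Γ : SimpleGraph V} (h : TwoGeodesicTransitive Γ)
    (h' : ¬ TwoArcTransitive Γ) : ∃ x y z, Γ.Adj x y ∧ Γ.Adj y z ∧ Γ.Adj x z := by
  by_contra! hno
  exact h' ⟨h.1, fun _ _ _ _ _ _ ha hb => h.2
    ⟨ha.1, ha.2.1, ha.2.2, hno _ _ _ ha.1 ha.2.1⟩ ⟨hb.1, hb.2.1, hb.2.2, hno _ _ _ hb.1 hb.2.1⟩⟩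

theorem stmt0 {V : Type*} [Fintype V] (Γ : SimpleGraph V) (p : ℕ)
    (hp : p.Prime)
    (hreg : ∀ v : V, Nat.card (Γ.neighborSet v) = p)
    (hconn : Γ.Connected)
    (hnc : Γ ≠ ⊤)
    (h2gt : TwoGeodesicTransitive Γ)
    (h2at : ¬ TwoArcTransitive Γ) :
    p % 4 = 1 := by
  classical
  have hdeg : ∀ v, Γ.degree v = p := fun v => by
    rw [← hreg v, Nat.card_eq_fintype_card, card_neighborSet_eq_degree]
  obtain ⟨a, b, d, hab, hbd, had⟩ := exists_triangle h2gt h2at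
  obtain ⟨x₀, u₀, w₀, hgeo⟩ := exists_is2Geodesic hconn hnc
  set l := (Γ.neighborFinset a ∩ Γ.neighborFinset b).card with hl
  have hl_pos : 0 < l := Finset.card_pos.2 ⟨d, by simp [hbd, had]⟩
  have hl_all : ∀ x y, Γ.Adj x y → (Γ.neighborFinset x ∩ Γ.neighborFinset y).card = l := by
    intro x y hxy
    obtain ⟨φ, rfl, rfl⟩ := h2gt.1 hab hxy
    exact card_inter_neighborFinset_map φ a b
  set c := (Γ.neighborFinset x₀ ∩ Γ.neighborFinset w₀).card with hc
  have hc_all : ∀ x u w, Is2Geodesic Γ x u w →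
      (Γ.neighborFinset x ∩ Γ.neighborFinset w).card = c := by
    intro x u w hxuw
    obtain ⟨φ, rfl, -, rfl⟩ := h2gt.2 hgeo hxuw
    exact card_inter_neighborFinset_map φ x₀ w₀
  set k := (farNeighbors Γ u₀ x₀).card with hk
  have hk_pos : 0 < k :=
    Finset.card_pos.2 ⟨w₀, mem_farNeighbors.2 ⟨hgeo.2.2.1.symm, hgeo.2.1, hgeo.2.2.2⟩⟩
  have hkl : k + 1 + l = p := by
    rw [← hdeg u₀, ← card_farNeighbors_add hgeo.1.symm, hl_all u₀ x₀ hgeo.1.symm]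
  have hk_all : ∀ u x, Γ.Adj u x → (farNeighbors Γ u x).card = k := by
    intro u x hux
    have := card_farNeighbors_add hux
    rw [hl_all u x hux, hdeg] at this
    omega
  have hS : (nonadjacencyGraph Γ u₀).IsRegularOfDegree k := fun x => by
    rw [degree_nonadjacencyGraph, hk_all u₀ x x.2]
  have hk_dvd : k ∣ p - 1 :=
    (h2gt.arcTransitive_nonadjacencyGraph u₀).valency_dvd hp (hreg u₀) hk_pos hS
  have hc_pos : 0 < c := Finset.card_pos.2 ⟨u₀, by simp [hgeo.1, hgeo.2.1.symm]⟩
  have hc_lt : c < p := by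
    have hle : c ≤ p := by
      rw [← hdeg x₀, ← card_neighborFinset_eq_degree]
      exact Finset.card_le_card Finset.inter_subset_left
    refine hle.lt_of_ne fun hcp => ?_
    have hdvd : k + 1 ∣ p := by
      rw [← hdeg u₀]
      refine succ_dvd_degree_of_twins (hk_all u₀) fun x y hy hux => ?_
      obtain ⟨hne, huy, hna⟩ := mem_farNeighbors.1 hy
      have hcard := hc_all x u₀ y ⟨hux.symm, huy, hne.symm, hna⟩
      have h1 := Finset.eq_of_subset_of_card_le
        (Finset.inter_subset_left (s₁ := Γ.neighborFinset x) (s₂ := Γ.neighborFinset y))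
        (by rw [hcard, card_neighborFinset_eq_degree, hdeg, hcp])
      have h2 := Finset.eq_of_subset_of_card_le
        (Finset.inter_subset_right (s₁ := Γ.neighborFinset x) (s₂ := Γ.neighborFinset y))
        (by rw [hcard, card_neighborFinset_eq_degree, hdeg, hcp])
      exact h2.symm.trans h1
    rcases (Nat.dvd_prime hp).1 hdvd with h | h <;> omega
  have hck : c ≤ k := by
    have hdvd : c ∣ p * k := by
      rw [← hdeg u₀]
      exact card_commonNeighbors_dvd (fun x hx => hk_all x u₀ hx.symm) (hc_all u₀)
    exact Nat.le_of_dvd hk_pos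
      ((Nat.coprime_of_lt_prime hc_pos.ne' hc_lt hp).symm.dvd_of_dvd_mul_left hdvd)
  have hbound := card_commonNeighbors_lower_bound hgeo
  rw [hl_all u₀ x₀ hgeo.1.symm, hl_all u₀ w₀ hgeo.2.1, hdeg, ← hc] at hbound
  have hpk : p = 2 * k + 1 := by
    obtain ⟨m, hm⟩ := hk_dvd
    have h1 : 1 < m := by
      by_contra! h
      have : k * m ≤ k * 1 := Nat.mul_le_mul_left k h
      omega
    have h3 : m < 3 := by
      by_contra! h
      have : k * 3 ≤ k * m := Nat.mul_le_mul_left k h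
      omega
    obtain rfl : m = 2 := by omega
    omega
  have heven : 2 ∣ p * k := by
    have := (nonadjacencyGraph Γ u₀).sum_degrees_eq_twice_card_edges
    rw [Finset.sum_congr rfl fun x _ => hS x, Finset.sum_const, smul_eq_mul, Finset.card_univ,
      ← Nat.card_eq_fintype_card, hreg] at this
    exact ⟨_, this⟩
  rcases Nat.prime_two.dvd_mul.1 heven with h | h <;> omega
end

section
/- Let Γ be a finite connected non-complete graph of prime valency p that is 2-geodesic transitive but not 2-arc transitive. Then for every 2-geodesic (v,u,w) of Γ, the number of common neighbours of v and w divides (p-1)/2. -/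
open SimpleGraph

open Polynomial in
theorem eval_add_sub_eval {R : Type*} [CommRing R] (P : R[X]) (x u : R) {n : ℕ}
    (hn : P.natDegree ≤ n) :
    P.eval (x + u) - P.eval x =
      ∑ j ∈ Finset.range n, (hasseDeriv (j + 1) P).eval x * u ^ (j + 1) := by
  have h : (taylor x P).eval u =
      ∑ i ∈ Finset.range (n + 1), (taylor x P).coeff i * u ^ i :=
    eval_eq_sum_range' (by rw [natDegree_taylor]; omega) u
  rw [taylor_eval, Finset.sum_range_succ', add_comm u x] at h
  simp only [taylor_coeff, pow_zero, mul_one, hasseDeriv_zero, LinearMap.id_apply] at h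
  rw [h, add_sub_cancel_right]

/-- The sum of the differences `f (x + u) - f x` over `u ∈ U`. -/
def translateSum {F : Type*} [CommRing F] (U : Finset F) (f : F → F) (x : F) : F :=
  ∑ u ∈ U, (f (x + u) - f x)

open Polynomial in
theorem translateSum_eval {F : Type*} [CommRing F] (U : Finset F) (P : F[X]) {n : ℕ}
    (hn : P.natDegree ≤ n) (x : F) :
    translateSum U (fun y => P.eval y) x =
      ∑ j ∈ Finset.range n, (hasseDeriv (j + 1) P).eval x * ∑ u ∈ U, u ^ (j + 1) := by
  simp only [translateSum, eval_add_sub_eval P _ _ hn, Finset.mul_sum]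
  exact Finset.sum_comm

open Polynomial in
theorem translateSum_eval_eq_zero {F : Type*} [CommRing F] {U : Finset F} {k : ℕ}
    (hU : ∀ j, 1 ≤ j → j < k → ∑ u ∈ U, u ^ j = 0) {P : F[X]} (hP : P.natDegree < k) (x : F) :
    translateSum U (fun y => P.eval y) x = 0 := by
  rw [translateSum_eval U P le_rfl]
  refine Finset.sum_eq_zero fun j hj => ?_
  rw [Finset.mem_range] at hj
  rw [hU _ (by omega) (by omega), mul_zero]

open Polynomial in
theorem natDegree_lt_of_translateSum_eq_zero {p : ℕ} [Fact p.Prime] {U : Finset (ZMod p)} {k : ℕ}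
    (hk : 1 ≤ k) (hU : ∀ j, 1 ≤ j → j < k → ∑ u ∈ U, u ^ j = 0) (hUk : ∑ u ∈ U, u ^ k ≠ 0)
    {P : (ZMod p)[X]} (hP : P.natDegree < p)
    (h : ∀ x, translateSum U (fun y => P.eval y) x = 0) :
    P.natDegree < k := by
  by_contra! hkn
  set n := P.natDegree with hn
  have hP0 : P ≠ 0 := by
    rintro rfl
    simp at hn
    omega
  set Q : (ZMod p)[X] :=
    ∑ j ∈ Finset.range n, C (∑ u ∈ U, u ^ (j + 1)) * hasseDeriv (j + 1) P with hQ
  have hQdeg : Q.natDegree < p := by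
    refine lt_of_le_of_lt (natDegree_sum_le_of_forall_le (n := n) _ _ fun j _ => ?_) hP
    exact (natDegree_C_mul_le _ _).trans ((natDegree_hasseDeriv_le _ _).trans (by omega))
  have hQ0 : Q = 0 := by
    refine eq_zero_of_natDegree_lt_card_of_eval_eq_zero Q (f := id) Function.injective_id
      (fun x => ?_) (by rwa [ZMod.card])
    rw [← h x, translateSum_eval U P le_rfl, hQ, eval_finsetSum]
    exact Finset.sum_congr rfl fun j _ => by rw [eval_mul, eval_C, mul_comm, id_eq]
  have hc : Q.coeff (n - k) = (∑ u ∈ U, u ^ k) * (n.choose k * P.leadingCoeff) := by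
    rw [hQ, finsetSum_coeff, Finset.sum_eq_single (k - 1)]
    · rw [Nat.sub_add_cancel hk, coeff_C_mul, hasseDeriv_coeff, Nat.sub_add_cancel hkn]
      rfl
    · intro j hj hjk
      rw [coeff_C_mul]
      rcases lt_or_gt_of_ne hjk with hlt | hgt
      · rw [hU _ (by omega) (by omega), zero_mul]
      · have hjn := Finset.mem_range.1 hj
        rw [coeff_eq_zero_of_natDegree_lt (lt_of_le_of_lt (natDegree_hasseDeriv_le _ _) (by omega)),
          mul_zero]
    · intro hj
      rw [Finset.mem_range] at hj
      omega
  rw [hQ0, coeff_zero] at hc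
  have hch : ((n.choose k : ℕ) : ZMod p) ≠ 0 := by
    rw [Ne, ZMod.natCast_eq_zero_iff]
    intro hd
    have := (Fact.out : p.Prime).dvd_factorial.1
      (hd.trans ⟨_, by rw [← mul_assoc, Nat.choose_mul_factorial_mul_factorial hkn]⟩ :
        p ∣ n.factorial)
    omega
  exact mul_ne_zero hUk (mul_ne_zero hch (leadingCoeff_ne_zero.2 hP0)) hc.symm

open Polynomial in
theorem sum_eval_zmod {p : ℕ} [Fact p.Prime] (P : (ZMod p)[X]) (hP : P.natDegree < p) :
    ∑ x, P.eval x = -P.coeff (p - 1) := by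
  have hp := (Fact.out : p.Prime).two_le
  have h1 : ∑ x : ZMod p, x ^ (p - 1) = -1 := by
    have : ∀ x : ZMod p, x ^ (p - 1) = 1 - if x = 0 then 1 else 0 := by
      intro x
      split_ifs with hx
      · rw [hx, zero_pow (by omega), sub_self]
      · rw [ZMod.pow_card_sub_one_eq_one hx, sub_zero]
    simp [this]
  simp only [eval_eq_sum_range' hP]
  rw [Finset.sum_comm, Finset.sum_eq_single (p - 1)]
  · rw [← Finset.mul_sum, h1, mul_neg_one]
  · intro i hi hip
    rw [Finset.mem_range] at hi
    rw [← Finset.mul_sum, FiniteField.sum_pow_lt_card_sub_one (ZMod p) i (by rw [ZMod.card]; omega),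
      mul_zero]
  · intro h
    rw [Finset.mem_range] at h
    omega

open Polynomial in
theorem exists_polynomial_eval_eq {p : ℕ} [Fact p.Prime] (f : ZMod p → ZMod p) :
    ∃ P : (ZMod p)[X], P.natDegree < p ∧ ∀ x, P.eval x = f x := by
  refine ⟨Lagrange.interpolate Finset.univ id f, ?_, fun x =>
    Lagrange.eval_interpolate_at_node f (Set.injOn_id _) (Finset.mem_univ x)⟩
  have hd := Lagrange.degree_interpolate_lt f
    (Set.injOn_id ((Finset.univ : Finset (ZMod p)) : Set (ZMod p)))
  rw [Finset.card_univ, ZMod.card] at hd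
  rcases eq_or_ne (Lagrange.interpolate Finset.univ id f) 0 with h | h
  · rw [h, natDegree_zero]
    exact (Fact.out : p.Prime).pos
  · exact (natDegree_lt_iff_degree_lt h).2 hd

theorem exists_sum_pow_ne_zero {p : ℕ} [Fact p.Prime] {U : Finset (ZMod p)} {s t : ZMod p}
    (h0 : (0 : ZMod p) ∉ U) (hs : s ∈ U) (ht : t ∉ U) (ht0 : t ≠ 0) :
    ∃ k, 1 ≤ k ∧ k + 1 < p ∧ ∑ u ∈ U, u ^ k ≠ 0 := by
  by_contra! h
  have hp := (Fact.out : p.Prime).two_le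
  have key : ∀ r : ZMod p, r ≠ 0 → (if r ∈ U then (-1 : ZMod p) else 0) = U.card := by
    intro r hr
    have h1 : ∀ u ∈ U, ∑ j ∈ Finset.range (p - 1), (u * r⁻¹) ^ j =
        if u = r then (-1 : ZMod p) else 0 := by
      intro u hu
      split_ifs with hur
      · rw [hur, mul_inv_cancel₀ hr]
        simp [Nat.cast_sub (by omega : 1 ≤ p)]
      · have hne : u * r⁻¹ ≠ 1 := fun h => hur (by
          rwa [mul_inv_eq_one₀ hr] at h)
        have hu0 : u ≠ 0 := fun h => h0 (h ▸ hu)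
        rw [geom_sum_eq hne, ZMod.pow_card_sub_one_eq_one (mul_ne_zero hu0 (inv_ne_zero hr)),
          sub_self, zero_div]
    have h2 := Finset.sum_congr rfl h1
    rw [Finset.sum_ite_eq' U r, Finset.sum_comm] at h2
    rw [← h2, Finset.sum_eq_single 0]
    · simp
    · intro j hj hj0
      rw [Finset.mem_range] at hj
      simp only [mul_pow]
      rw [← Finset.sum_mul, h j (by omega) (by omega), zero_mul]
    · intro h
      rw [Finset.mem_range] at h
      omega
  have hs' := key s fun h => h0 (h ▸ hs)
  have ht' := key t ht0
  rw [if_pos hs] at hs'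
  rw [if_neg ht, ← hs'] at ht'
  simp at ht'

theorem translateSum_comp {F : Type*} [CommRing F] (U : Finset F) (f : F → F) (π : F ≃ F)
    (hπ : ∀ i j, j - i ∈ U ↔ π j - π i ∈ U) (x : F) :
    translateSum U (fun y => f (π y)) x = translateSum U f (π x) := by
  unfold translateSum
  refine Finset.sum_bij' (fun u _ => π (x + u) - π x) (fun v _ => π.symm (π x + v) - x)
    ?_ ?_ ?_ ?_ ?_
  · intro u hu
    rw [← hπ]
    simpa using hu
  · intro v hv
    rw [hπ]
    simpa using hv
  · intro u _
    simp
  · intro v _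
    simp
  · intro u _
    simp

open Polynomial in
/-- **Müller's lemma**: a permutation of `ZMod p` preserving the differences in a symmetric proper
nonempty set of nonzero residues is affine. -/
theorem affine_of_preserves_differences {p : ℕ} [Fact p.Prime] {U : Finset (ZMod p)} {s t : ZMod p}
    (h0 : (0 : ZMod p) ∉ U) (hs : s ∈ U) (ht : t ∉ U) (ht0 : t ≠ 0) (hneg : ∀ u ∈ U, -u ∈ U)
    (π : ZMod p ≃ ZMod p) (hπ : ∀ i j, j - i ∈ U ↔ π j - π i ∈ U) :
    ∃ a b : ZMod p, ∀ x, π x = a * x + b := by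
  classical
  have hex := exists_sum_pow_ne_zero h0 hs ht ht0
  set k := Nat.find hex with hkdef
  obtain ⟨hk1, hkp, hUk⟩ := Nat.find_spec hex
  rw [← hkdef] at hk1 hkp hUk
  have hU : ∀ j, 1 ≤ j → j < k → ∑ u ∈ U, u ^ j = 0 := by
    intro j hj hjk
    by_contra hne
    exact Nat.find_min hex hjk ⟨hj, by omega, hne⟩
  have hk2 : 2 ≤ k := by
    by_contra! hlt
    have hk : k = 1 := by omega
    simp only [hk, pow_one] at hUk hkp
    have hsum : ∑ u ∈ U, u = -∑ u ∈ U, u := by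
      rw [← Finset.sum_neg_distrib]
      exact Finset.sum_nbij' (fun u => -u) (fun u => -u) hneg hneg (by simp) (by simp) (by simp)
    have h2 : (2 : ZMod p) * ∑ u ∈ U, u = 0 := by linear_combination hsum
    rcases mul_eq_zero.1 h2 with h2 | h2
    · have : p ∣ 2 := (ZMod.natCast_eq_zero_iff 2 p).1 (by exact_mod_cast h2)
      exact absurd (Nat.le_of_dvd two_pos this) (by omega)
    · exact hUk h2
  have hπ' : ∀ i j, j - i ∈ U ↔ π.symm j - π.symm i ∈ U := fun i j => by
    rw [hπ (π.symm i) (π.symm j)]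
    simp
  have deg_pow : ∀ (ρ : ZMod p ≃ ZMod p), (∀ i j, j - i ∈ U ↔ ρ j - ρ i ∈ U) →
      ∀ (P : (ZMod p)[X]) (i : ℕ), P.natDegree < p → (∀ x, P.eval x = ρ x ^ i) → i < k →
      P.natDegree < k := by
    intro ρ hρ P i hP hPρ hi
    refine natDegree_lt_of_translateSum_eq_zero hk1 hU hUk hP fun x => ?_
    simp only [hPρ]
    rw [translateSum_comp U (fun y => y ^ i) ρ hρ]
    simpa using translateSum_eval_eq_zero hU (P := X ^ i) (by simpa using hi) (ρ x)
  obtain ⟨P, hP, hPπ⟩ := exists_polynomial_eval_eq π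
  have hnk : P.natDegree < k := deg_pow π hπ P 1 hP (by simpa using hPπ) (by omega)
  set n := P.natDegree with hn
  have hnle : n ≤ 1 := by
    by_contra! hn2
    have hP0 : P ≠ 0 := by
      rintro rfl
      simp at hn
      omega
    have hnkp : n + k ≤ p - 1 := by
      by_contra! hlt
      obtain ⟨R, hR, hRπ⟩ := exists_polynomial_eval_eq fun x => π.symm x ^ (p - 1 - n)
      have hRk := deg_pow π.symm hπ' R (p - 1 - n) hR hRπ (by omega)
      have e1 : (P * X ^ (p - 1 - n)).natDegree = p - 1 := by
        rw [natDegree_mul_X_pow _ hP0, ← hn]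
        omega
      have e2 : (X * R).natDegree < p - 1 :=
        lt_of_le_of_lt (natDegree_mul_le.trans (Nat.add_le_add_right natDegree_X_le _)) (by omega)
      have s1 := sum_eval_zmod (P * X ^ (p - 1 - n)) (by omega)
      have s2 := sum_eval_zmod (X * R) (by omega)
      rw [coeff_eq_zero_of_natDegree_lt e2, neg_zero] at s2
      have e3 : ∑ x, (P * X ^ (p - 1 - n)).eval x = ∑ x, (X * R).eval x := by
        refine Fintype.sum_equiv π _ _ fun x => ?_
        simp [hPπ, hRπ]
      have e4 : (P * X ^ (p - 1 - n)).leadingCoeff = 0 := by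
        rw [leadingCoeff, e1, ← neg_eq_zero, ← s1, e3, s2]
      exact mul_ne_zero hP0 (pow_ne_zero _ X_ne_zero) (leadingCoeff_eq_zero.1 e4)
    set i := (k - 1) / n + 1 with hi
    have hik : i < k := by
      have : (k - 1) / n ≤ (k - 1) / 2 := Nat.div_le_div_left hn2 two_pos
      omega
    have hlow : k ≤ i * n := by
      have := Nat.lt_div_mul_add (a := k - 1) (b := n) (by omega)
      rw [hi, add_mul]
      omega
    have hhigh : i * n ≤ k - 1 + n := by
      have := Nat.div_mul_le_self (k - 1) n
      rw [hi, add_mul]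
      omega
    have := deg_pow π hπ (P ^ i) i (by rw [natDegree_pow, ← hn]; omega) (by simp [hPπ]) hik
    rw [natDegree_pow, ← hn] at this
    omega
  obtain ⟨a, b, hab⟩ := exists_eq_X_add_C_of_natDegree_le_one hnle
  exact ⟨a, b, fun x => by rw [← hPπ, hab]; simp⟩

theorem exists_equiv_zmod {X : Type*} [Finite X] {p : ℕ} [Fact p.Prime] (hX : Nat.card X = p)
    {σ : Equiv.Perm X} (hσ : orderOf σ = p) (x : X) :
    ∃ e : ZMod p ≃ X, e 0 = x ∧ ∀ i j, e (i + j) = (σ ^ j.val) (e i) := by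
  have hp : p.Prime := Fact.out
  obtain ⟨y, hy⟩ : ∃ y, σ y ≠ y := by
    by_contra! h
    have h1 : σ = 1 := Equiv.ext h
    rw [h1, orderOf_one] at hσ
    exact hp.one_lt.ne hσ
  have hper : Function.minimalPeriod σ y = p := by
    refine Function.minimalPeriod_eq_prime ?_ hy
    change σ^[p] y = y
    rw [← Equiv.Perm.coe_pow, ← hσ, pow_orderOf_eq_one]
    rfl
  set f : ZMod p → X := fun i => (σ ^ i.val) y with hf
  have hinj : Function.Injective f := by
    intro i j hij
    apply ZMod.val_injective p
    refine Function.iterate_injOn_Iio_minimalPeriod (f := σ) (x := y) ?_ ?_ ?_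
    · rw [hper]; exact ZMod.val_lt i
    · rw [hper]; exact ZMod.val_lt j
    · simpa [hf, Equiv.Perm.coe_pow] using hij
  have hbij : Function.Bijective f :=
    (Nat.bijective_iff_injective_and_card f).2 ⟨hinj, by rw [Nat.card_zmod, hX]⟩
  have hadd : ∀ i j, f (i + j) = (σ ^ j.val) (f i) := by
    intro i j
    simp only [hf]
    rw [← Equiv.Perm.mul_apply, ← pow_add, ZMod.val_add, add_comm j.val]
    have hmod : ∀ n : ℕ, σ ^ (n % p) = σ ^ n := hσ ▸ pow_mod_orderOf σ
    rw [hmod]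
  obtain ⟨c, hc⟩ := hbij.2 x
  refine ⟨(Equiv.addLeft c).trans (Equiv.ofBijective f hbij), by simpa using hc, fun i j => ?_⟩
  simp [← add_assoc, hadd]

theorem exists_perm_orderOf_eq {X : Type*} [Finite X] (H : SimpleGraph X) {p : ℕ} [Fact p.Prime]
    (hX : Nat.card X = p) (hvt : ∀ x y, ∃ φ : H ≃g H, φ x = y) :
    ∃ σ : Equiv.Perm X, orderOf σ = p ∧ ∀ x y, H.Adj (σ x) (σ y) ↔ H.Adj x y := by
  have hp : p.Prime := Fact.out
  let G : Subgroup (Equiv.Perm X) :=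
    { carrier := {σ | ∀ x y, H.Adj (σ x) (σ y) ↔ H.Adj x y}
      mul_mem' := fun {a b} ha hb x y => by
        rw [Equiv.Perm.mul_apply, Equiv.Perm.mul_apply, ha, hb]
      one_mem' := fun x y => Iff.rfl
      inv_mem' := fun {a} ha x y => by
        rw [← ha]
        simp }
  have : MulAction.IsPretransitive G X := ⟨fun x y => by
    obtain ⟨φ, hφ⟩ := hvt x y
    exact ⟨⟨φ.toEquiv, fun a b => φ.map_adj_iff⟩, hφ⟩⟩
  obtain ⟨x⟩ : Nonempty X := by
    by_contra h
    rw [not_nonempty_iff] at h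
    rw [Nat.card_of_isEmpty] at hX
    exact hp.ne_zero hX.symm
  have hdvd : p ∣ Nat.card G := by
    rw [← hX, ← MulAction.index_stabilizer_of_transitive G x]
    exact Subgroup.index_dvd_card _
  obtain ⟨σ, hσ⟩ := exists_prime_orderOf_dvd_card' p hdvd
  exact ⟨σ, by rw [Subgroup.orderOf_coe, hσ], σ.2⟩

/-- The valency of an arc-transitive, non-complete, nonempty graph of prime order `p` divides
`p - 1`. -/
theorem card_neighborSet_dvd_sub_one {X : Type*} [Finite X] (H : SimpleGraph X) {p : ℕ}
    (hp : p.Prime) (hX : Nat.card X = p) (hvt : ∀ x y, ∃ φ : H ≃g H, φ x = y)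
    (hat : ∀ x y z, H.Adj x y → H.Adj x z → ∃ φ : H ≃g H, φ x = x ∧ φ y = z)
    {x y z : X} (hxy : H.Adj x y) (hzx : z ≠ x) (hxz : ¬ H.Adj x z) :
    Nat.card (H.neighborSet x) ∣ p - 1 := by
  classical
  have : Fact p.Prime := ⟨hp⟩
  obtain ⟨σ, hσ, hσH⟩ := exists_perm_orderOf_eq H hX hvt
  obtain ⟨e, he0, hadd⟩ := exists_equiv_zmod hX hσ x
  have hpow : ∀ (n : ℕ) (a b : X), H.Adj ((σ ^ n) a) ((σ ^ n) b) ↔ H.Adj a b := by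
    intro n
    induction n with
    | zero => simp
    | succ n ih => intro a b; rw [pow_succ, Equiv.Perm.mul_apply, Equiv.Perm.mul_apply, ih, hσH]
  set U : Finset (ZMod p) := Finset.univ.filter fun i => H.Adj x (e i) with hUdef
  have hU : ∀ i, i ∈ U ↔ H.Adj x (e i) := fun i => by simp [hUdef]
  have hadj : ∀ i j, H.Adj (e i) (e j) ↔ j - i ∈ U := by
    intro i j
    rw [hU, ← hpow i.val x, ← hadd, sub_add_cancel, ← he0, ← hadd, zero_add]
  have h0 : (0 : ZMod p) ∉ U := by rw [hU, he0]; exact H.loopless.irrefl x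
  have hneg : ∀ u ∈ U, -u ∈ U := by
    intro u hu
    rw [← zero_sub, ← hadj, adj_comm, he0]
    exact (hU u).1 hu
  set s := e.symm y with hs
  have hsU : s ∈ U := by rw [hU]; simpa [hs] using hxy
  have hs0 : s ≠ 0 := fun h => h0 (h ▸ hsU)
  have htU : e.symm z ∉ U := by rw [hU]; simpa using hxz
  have ht0 : e.symm z ≠ 0 := by rw [Ne, Equiv.symm_apply_eq, he0]; exact hzx
  let K : Subgroup (ZMod p)ˣ :=
    { carrier := {a | ∀ i : ZMod p, (a : ZMod p) * i ∈ U ↔ i ∈ U}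
      mul_mem' := fun {a b} ha hb i => by rw [Units.val_mul, mul_assoc, ha, hb]
      one_mem' := fun i => by rw [Units.val_one, one_mul]
      inv_mem' := fun {a} ha i => by rw [← ha, Units.mul_inv_cancel_left] }
  have hcard : Nat.card K = Nat.card (H.neighborSet x) := by
    refine Nat.card_congr (Equiv.ofBijective
      (fun a : K => (⟨e ((a : (ZMod p)ˣ) * s), (hU _).1 ((a.2 s).2 hsU)⟩ : H.neighborSet x))
      ⟨?_, ?_⟩)
    · intro a b hab
      have h1 := e.injective (Subtype.ext_iff.1 hab)
      exact Subtype.ext (Units.ext (mul_right_cancel₀ hs0 h1))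
    · rintro ⟨w, hw⟩
      obtain ⟨φ, hφx, hφy⟩ := hat x y w hxy hw
      let π : ZMod p ≃ ZMod p := (e.trans φ.toEquiv).trans e.symm
      have heπ : ∀ i, e (π i) = φ (e i) := fun i => by simp [π]
      have hπ : ∀ i j, j - i ∈ U ↔ π j - π i ∈ U := by
        intro i j
        rw [← hadj, ← hadj, heπ, heπ]
        exact φ.map_adj_iff.symm
      obtain ⟨a, b, hab⟩ := affine_of_preserves_differences h0 hsU htU ht0 hneg π hπ
      have hπ0 : π 0 = 0 := e.injective (by rw [heπ, he0, hφx])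
      have hb : b = 0 := by rw [hab] at hπ0; simpa using hπ0
      have hlin : ∀ i, π i = a * i := fun i => by rw [hab, hb, add_zero]
      have ha : a ≠ 0 := by
        rintro rfl
        refine hs0 (π.injective ?_)
        rw [hlin, hlin, zero_mul, zero_mul]
      refine ⟨⟨Units.mk0 a ha, fun i => ?_⟩, Subtype.ext ?_⟩
      · have := hπ 0 i
        rw [hπ0, sub_zero, sub_zero, hlin] at this
        exact this.symm
      · change e (a * s) = w
        rw [← hlin, heπ, hs, Equiv.apply_symm_apply, hφy]
  rw [← hcard]
  have := Subgroup.card_subgroup_dvd_card K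
  rwa [Nat.card_eq_fintype_card, Nat.card_eq_fintype_card, ZMod.card_units_eq_totient,
    Nat.totient_prime hp, ← Nat.card_eq_fintype_card] at this

theorem exists_compl_induce_neighborSet_iso {V : Type*} {Γ : SimpleGraph V} {u : V} (φ : Γ ≃g Γ)
    (hφ : φ u = u) :
    ∃ ψ : (Γ.induce (Γ.neighborSet u))ᶜ ≃g (Γ.induce (Γ.neighborSet u))ᶜ,
      ∀ x, (ψ x : V) = φ x := by
  let e : Γ.neighborSet u ≃ Γ.neighborSet u := φ.toEquiv.subtypeEquiv fun x => by
    change Γ.Adj u x ↔ Γ.Adj u (φ x)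
    conv_rhs => rw [← hφ]
    exact φ.map_adj_iff.symm
  refine ⟨⟨e, fun {a b} => ?_⟩, fun x => rfl⟩
  rw [compl_adj, compl_adj, comap_adj, comap_adj, e.injective.ne_iff]
  exact and_congr_right fun _ => not_congr φ.map_adj_iff

open Classical in
/-- The neighbours of `u` other than `v` that are not adjacent to `v`. -/
noncomputable def nonAdjNeighbors {V : Type*} [Fintype V] (Γ : SimpleGraph V) (u v : V) :
    Finset V :=
  Finset.univ.filter fun w => Γ.Adj u w ∧ v ≠ w ∧ ¬ Γ.Adj v w

theorem mem_nonAdjNeighbors {V : Type*} [Fintype V] {Γ : SimpleGraph V} {u v w : V} :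
    w ∈ nonAdjNeighbors Γ u v ↔ Γ.Adj u w ∧ v ≠ w ∧ ¬ Γ.Adj v w := by
  simp [nonAdjNeighbors]

theorem card_nonAdjNeighbors_eq {V : Type*} [Fintype V] {Γ : SimpleGraph V}
    (h : ArcTransitive Γ) {u v u' v' : V} (huv : Γ.Adj u v) (huv' : Γ.Adj u' v') :
    (nonAdjNeighbors Γ u v).card = (nonAdjNeighbors Γ u' v').card := by
  obtain ⟨φ, rfl, rfl⟩ := h huv huv'
  refine Finset.card_equiv φ.toEquiv fun w => ?_
  rw [mem_nonAdjNeighbors, mem_nonAdjNeighbors]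
  change _ ↔ Γ.Adj (φ u) (φ w) ∧ φ v ≠ φ w ∧ ¬ Γ.Adj (φ v) (φ w)
  rw [φ.map_adj_iff, φ.map_adj_iff, φ.injective.ne_iff]

theorem exists_common_neighbor {V : Type*} {Γ : SimpleGraph V} (h2gt : TwoGeodesicTransitive Γ)
    (h2at : ¬ TwoArcTransitive Γ) {u v : V} (huv : Γ.Adj u v) : ∃ z, Γ.Adj u z ∧ Γ.Adj v z := by
  by_contra! hno
  have hgeo : ∀ ⦃a b c⦄, Is2Arc Γ a b c → Is2Geodesic Γ a b c := by
    rintro a b c ⟨hab, hbc, hac⟩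
    refine ⟨hab, hbc, hac, fun h => ?_⟩
    obtain ⟨φ, rfl, rfl⟩ := h2gt.1 hab huv
    exact hno (φ c) (φ.map_adj_iff.2 h) (φ.map_adj_iff.2 hbc)
  exact h2at ⟨h2gt.1, fun v u w v' u' w' h h' => h2gt.2 (hgeo h) (hgeo h')⟩

theorem card_nonAdjNeighbors_dvd {V : Type*} [Fintype V] {Γ : SimpleGraph V} {p : ℕ}
    (hp : p.Prime) (hreg : ∀ v : V, Nat.card (Γ.neighborSet v) = p)
    (h2gt : TwoGeodesicTransitive Γ) {u v w z : V} (hg : Is2Geodesic Γ v u w) (huz : Γ.Adj u z)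
    (hvz : Γ.Adj v z) :
    (nonAdjNeighbors Γ u v).card ∣ p - 1 := by
  obtain ⟨hvu, huw, hvw, hnvw⟩ := hg
  set H := (Γ.induce (Γ.neighborSet u))ᶜ with hH
  have hadj : ∀ a b : Γ.neighborSet u, H.Adj a b ↔ (a : V) ≠ b ∧ ¬ Γ.Adj a b := fun a b => by
    rw [hH, compl_adj, comap_adj, Ne, Subtype.ext_iff]
    rfl
  have hcard : Nat.card (H.neighborSet ⟨v, hvu.symm⟩) = (nonAdjNeighbors Γ u v).card := by
    rw [← Nat.card_eq_finsetCard]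
    exact Nat.card_congr
      ⟨fun x => ⟨x.1, mem_nonAdjNeighbors.2 ⟨x.1.2, (hadj _ _).1 x.2⟩⟩,
        fun x => ⟨⟨x, (mem_nonAdjNeighbors.1 x.2).1⟩,
          (hadj _ _).2 (mem_nonAdjNeighbors.1 x.2).2⟩, fun x => rfl, fun x => rfl⟩
  rw [← hcard]
  refine card_neighborSet_dvd_sub_one H hp (hreg u) ?_ ?_ (y := ⟨w, huw⟩) (z := ⟨z, huz⟩)
    ((hadj _ _).2 ⟨hvw, hnvw⟩) (fun h => hvz.ne' (Subtype.ext_iff.1 h))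
    (fun h => ((hadj _ _).1 h).2 hvz)
  · rintro ⟨x, hx⟩ ⟨y, hy⟩
    obtain ⟨φ, h1, h2⟩ := h2gt.1 hx hy
    obtain ⟨ψ, hψ⟩ := exists_compl_induce_neighborSet_iso φ h1
    exact ⟨ψ, Subtype.ext ((hψ _).trans h2)⟩
  · rintro ⟨a, ha⟩ ⟨b, hb⟩ ⟨c, hc⟩ hab hac
    obtain ⟨φ, h1, h2, h3⟩ := h2gt.2 ⟨ha.symm, hb, (hadj _ _).1 hab⟩
      ⟨ha.symm, hc, (hadj _ _).1 hac⟩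
    obtain ⟨ψ, hψ⟩ := exists_compl_induce_neighborSet_iso φ h2
    exact ⟨ψ, Subtype.ext ((hψ _).trans h1), Subtype.ext ((hψ _).trans h3)⟩

theorem card_common_neighbors_mul {V : Type*} [Fintype V] [DecidableEq V] {Γ : SimpleGraph V}
    [DecidableRel Γ.Adj] {p : ℕ} (hreg : ∀ v, Γ.degree v = p) (h2gt : TwoGeodesicTransitive Γ)
    {u v w : V} (hg : Is2Geodesic Γ v u w) :
    (Γ.neighborFinset v ∩ Γ.neighborFinset w).card ∣ p * (nonAdjNeighbors Γ u v).card := by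
  obtain ⟨hvu, huw, hvw, hnvw⟩ := hg
  set S : Finset V :=
    Finset.univ.filter fun y => v ≠ y ∧ ¬ Γ.Adj v y ∧ ∃ x, Γ.Adj v x ∧ Γ.Adj x y with hS
  refine ⟨S.card, ?_⟩
  rw [mul_comm _ S.card, ← hreg v, ← Γ.card_neighborFinset_eq_degree]
  refine Finset.card_mul_eq_card_mul Γ.Adj (fun x hx => ?_) fun y hy => ?_
  · rw [mem_neighborFinset] at hx
    rw [card_nonAdjNeighbors_eq h2gt.1 hvu.symm hx.symm]
    congr 1
    ext y
    simp only [hS, Finset.mem_bipartiteAbove, Finset.mem_filter_univ, mem_nonAdjNeighbors]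
    exact ⟨fun h => ⟨h.2, h.1.1, h.1.2.1⟩, fun h => ⟨⟨h.2.1, h.2.2, x, hx, h.1⟩, h.1⟩⟩
  · simp only [hS, Finset.mem_filter_univ] at hy
    obtain ⟨h1, h2, x, h3, h4⟩ := hy
    obtain ⟨φ, hφv, -, hφw⟩ := h2gt.2 ⟨h3, h4, h1, h2⟩ ⟨hvu, huw, hvw, hnvw⟩
    refine Finset.card_equiv φ.toEquiv fun a => ?_
    simp only [Finset.mem_bipartiteBelow, Finset.mem_inter, mem_neighborFinset]
    change _ ↔ Γ.Adj v (φ a) ∧ Γ.Adj w (φ a)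
    conv_rhs => rw [← hφv, ← hφw]
    rw [φ.map_adj_iff, φ.map_adj_iff, Γ.adj_comm a y]

theorem add_one_le_card_common_neighbors_add {V : Type*} [Fintype V] [DecidableEq V]
    {Γ : SimpleGraph V} [DecidableRel Γ.Adj] {u v w : V} (hg : Is2Geodesic Γ v u w) :
    Γ.degree u + 1 ≤ (Γ.neighborFinset v ∩ Γ.neighborFinset w).card +
      ((nonAdjNeighbors Γ u v).card + (nonAdjNeighbors Γ u w).card) := by
  obtain ⟨hvu, huw, hvw, hnvw⟩ := hg
  have hu : u ∈ Γ.neighborFinset v ∩ Γ.neighborFinset w := by simp [hvu, huw.symm]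
  have hsub : Γ.neighborFinset u ⊆ (Γ.neighborFinset v ∩ Γ.neighborFinset w).erase u ∪
      (nonAdjNeighbors Γ u v ∪ nonAdjNeighbors Γ u w) := by
    intro x hx
    rw [mem_neighborFinset] at hx
    simp only [Finset.mem_union, Finset.mem_erase, Finset.mem_inter, mem_neighborFinset,
      mem_nonAdjNeighbors]
    have h1 := hx.ne'
    by_cases hxv : v = x
    · subst hxv
      exact Or.inr (Or.inr ⟨hx, hvw.symm, fun h => hnvw h.symm⟩)
    by_cases hxw : w = x
    · subst hxw
      exact Or.inr (Or.inl ⟨hx, hvw, hnvw⟩)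
    tauto
  have h1 := Finset.card_le_card hsub
  have h2 := Finset.card_union_le ((Γ.neighborFinset v ∩ Γ.neighborFinset w).erase u)
    (nonAdjNeighbors Γ u v ∪ nonAdjNeighbors Γ u w)
  have h3 := Finset.card_union_le (nonAdjNeighbors Γ u v) (nonAdjNeighbors Γ u w)
  have h4 := Finset.card_erase_add_one hu
  rw [card_neighborFinset_eq_degree] at h1
  omega

theorem card_nonAdjNeighbors_add_one_dvd {V : Type*} [Fintype V] [DecidableEq V]
    {Γ : SimpleGraph V} [DecidableRel Γ.Adj] (hat : ArcTransitive Γ)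
    (htwin : ∀ v u w, Is2Geodesic Γ v u w → Γ.neighborFinset v = Γ.neighborFinset w)
    {u v : V} (huv : Γ.Adj u v) :
    (nonAdjNeighbors Γ u v).card + 1 ∣ Γ.degree u := by
  rw [← card_neighborFinset_eq_degree,
    Finset.card_eq_sum_card_image (fun y => Γ.neighborFinset y) (Γ.neighborFinset u)]
  refine Finset.dvd_sum fun s hs => ?_
  obtain ⟨x, hx, rfl⟩ := Finset.mem_image.1 hs
  rw [mem_neighborFinset] at hx
  have hfib : (Γ.neighborFinset u).filter (fun y => Γ.neighborFinset y = Γ.neighborFinset x) =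
      insert x (nonAdjNeighbors Γ u x) := by
    ext y
    rw [Finset.mem_filter, Finset.mem_insert, mem_nonAdjNeighbors, mem_neighborFinset]
    constructor
    · rintro ⟨hy, hyx⟩
      by_cases hxy : y = x
      · exact Or.inl hxy
      · refine Or.inr ⟨hy, Ne.symm hxy, fun h => ?_⟩
        rw [← mem_neighborFinset, ← hyx, mem_neighborFinset] at h
        exact h.ne rfl
    · rintro (rfl | ⟨h1, h2, h3⟩)
      · exact ⟨hx, rfl⟩
      · exact ⟨h1, (htwin x u y ⟨hx.symm, h1, h2, h3⟩).symm⟩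
  rw [hfib, Finset.card_insert_of_notMem fun h => (mem_nonAdjNeighbors.1 h).2.1 rfl,
    card_nonAdjNeighbors_eq hat huv hx]

theorem card_common_neighbors_ne {V : Type*} [Fintype V] [DecidableEq V] {Γ : SimpleGraph V}
    [DecidableRel Γ.Adj] {p : ℕ} (hp : p.Prime) (hreg : ∀ v, Γ.degree v = p)
    (h2gt : TwoGeodesicTransitive Γ) {u v w : V} (hg : Is2Geodesic Γ v u w)
    (hlt : (nonAdjNeighbors Γ u v).card + 1 < p) :
    (Γ.neighborFinset v ∩ Γ.neighborFinset w).card ≠ p := by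
  intro hc
  have hpos : 0 < (nonAdjNeighbors Γ u v).card :=
    Finset.card_pos.2 ⟨w, mem_nonAdjNeighbors.2 hg.2⟩
  have h1 : Γ.neighborFinset v ∩ Γ.neighborFinset w = Γ.neighborFinset v :=
    Finset.eq_of_subset_of_card_le Finset.inter_subset_left
      (by rw [hc, card_neighborFinset_eq_degree, hreg])
  have h2 : Γ.neighborFinset v ∩ Γ.neighborFinset w = Γ.neighborFinset w :=
    Finset.eq_of_subset_of_card_le Finset.inter_subset_right
      (by rw [hc, card_neighborFinset_eq_degree, hreg])
  have htwin : ∀ a b c, Is2Geodesic Γ a b c → Γ.neighborFinset a = Γ.neighborFinset c := by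
    intro a b c h
    obtain ⟨φ, hφv, -, hφw⟩ := h2gt.2 h hg
    ext x
    have := Finset.ext_iff.1 (h1.symm.trans h2) (φ x)
    rw [mem_neighborFinset, mem_neighborFinset, ← hφv, ← hφw, φ.map_adj_iff, φ.map_adj_iff] at this
    simpa using this
  have hdvd := card_nonAdjNeighbors_add_one_dvd h2gt.1 htwin hg.1.symm
  rw [hreg, Nat.dvd_prime hp] at hdvd
  omega

theorem stmt3 {V : Type*} [Fintype V] (Γ : SimpleGraph V) (p : ℕ)
    (hp : p.Prime)
    (hreg : ∀ v : V, Nat.card (Γ.neighborSet v) = p)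
    (hconn : Γ.Connected)
    (hnc : Γ ≠ ⊤)
    (h2gt : TwoGeodesicTransitive Γ)
    (h2at : ¬ TwoArcTransitive Γ) :
    ∀ v u w : V, Is2Geodesic Γ v u w →
      Nat.card {x : V | Γ.Adj v x ∧ Γ.Adj w x} ∣ (p - 1) / 2 := by
  classical
  intro v u w hg
  obtain ⟨z, huz, hvz⟩ := exists_common_neighbor h2gt h2at hg.1.symm
  have hdeg : ∀ v, Γ.degree v = p := fun v => by
    rw [← hreg v, Nat.card_eq_fintype_card, card_neighborSet_eq_degree]
  have hC : Nat.card {x : V | Γ.Adj v x ∧ Γ.Adj w x} =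
      (Γ.neighborFinset v ∩ Γ.neighborFinset w).card := by
    rw [Nat.card_coe_set_eq, ← Set.ncard_coe_finset]
    congr 1
    ext x
    simp
  rw [hC]
  set c := (Γ.neighborFinset v ∩ Γ.neighborFinset w).card with hc
  have hmdvd := card_nonAdjNeighbors_dvd hp hreg h2gt hg huz hvz
  have hcdvd := card_common_neighbors_mul hdeg h2gt hg
  have hineq := add_one_le_card_common_neighbors_add hg
  rw [← card_nonAdjNeighbors_eq h2gt.1 hg.1.symm hg.2.1, hdeg, ← hc] at hineq
  rw [← hc] at hcdvd
  have hmpos : 0 < (nonAdjNeighbors Γ u v).card :=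
    Finset.card_pos.2 ⟨w, mem_nonAdjNeighbors.2 hg.2⟩
  have hlt : (nonAdjNeighbors Γ u v).card + 1 < p := by
    have hsub : insert z (insert v (nonAdjNeighbors Γ u v)) ⊆ Γ.neighborFinset u := by
      intro x hx
      rw [mem_neighborFinset]
      simp only [Finset.mem_insert, mem_nonAdjNeighbors] at hx
      rcases hx with rfl | rfl | hx
      exacts [huz, hg.1.symm, hx.1]
    have hcard := Finset.card_le_card hsub
    rw [Finset.card_insert_of_notMem, Finset.card_insert_of_notMem, card_neighborFinset_eq_degree,
      hdeg] at hcard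
    · omega
    · exact fun h => (mem_nonAdjNeighbors.1 h).2.1 rfl
    · rw [Finset.mem_insert, mem_nonAdjNeighbors]
      rintro (h | h)
      · exact hvz.ne' h
      · exact h.2.2 hvz
  have hcp : c ≠ p := card_common_neighbors_ne hp hdeg h2gt hg hlt
  have hcle : c ≤ p := by
    rw [← hdeg v, ← card_neighborFinset_eq_degree]
    exact Finset.card_le_card Finset.inter_subset_left
  generalize (nonAdjNeighbors Γ u v).card = m at *
  have hcpos : 0 < c := Nat.pos_of_ne_zero fun h0 => by
    rw [h0, zero_dvd_iff, mul_eq_zero] at hcdvd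
    omega
  have hcm : c ∣ m := by
    refine Nat.Coprime.dvd_of_dvd_mul_left ?_ hcdvd
    exact (Nat.coprime_of_lt_prime hcpos.ne' (by omega) hp).symm
  have hcm' := Nat.le_of_dvd hmpos hcm
  obtain ⟨k, hk⟩ := hmdvd
  have hk2 : k = 2 := by
    have h1 : k < 3 := by
      by_contra! h
      have := Nat.mul_le_mul_left m h
      omega
    interval_cases k <;> omega
  rw [hk, hk2, Nat.mul_div_cancel _ two_pos]
  exact hcm
end
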